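/- For a convex cone subequation F ⊆ Sym²(ℝⁿ) with edge E = F ∩ (−F) and polar cone F₊, the following are equivalent: (i) F is extremely degenerate, i.e., there exists a proper linear subspace W ⊊ ℝⁿ with F₊ ⊆ Sym²(W); (ii) E ∩ 𝒫 ≠ {0}; (iii) there exists a unit vector e ∈ ℝⁿ with P_e ∈ E; (iv) there exists a unit vector e ∈ ℝⁿ with −P_e ∈ F. -/

import Mathlib

open Matrix Set Pointwise

noncomputable section

/-- `Sym²(ℝⁿ)`: the space of real symmetric `n × n` matrices,
realized as the self-adjoint elements of the matrix algebra. -/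
abbrev SymMat (n : ℕ) : Type := ↥(selfAdjoint (Matrix (Fin n) (Fin n) ℝ))

namespace SymMat

variable {n : ℕ}

/-- The trace inner product `⟨A, B⟩ = tr (A * B)` on `Sym²(ℝⁿ)`. -/
def tinner (A B : SymMat n) : ℝ :=
  ((A : Matrix (Fin n) (Fin n) ℝ) * (B : Matrix (Fin n) (Fin n) ℝ)).trace

/-- `𝒫`: the closed convex cone of positive semidefinite matrices. -/
def Psd (n : ℕ) : Set (SymMat n) :=
  {A | (A : Matrix (Fin n) (Fin n) ℝ).PosSemidef}

/-- The set of positive definite matrices (= `Int 𝒫`). -/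
def Pd (n : ℕ) : Set (SymMat n) :=
  {A | (A : Matrix (Fin n) (Fin n) ℝ).PosDef}

/-- A convex cone subequation: a closed convex cone `F ⊆ Sym²(ℝⁿ)` which is a nonempty
proper subset and satisfies the positivity condition `F + 𝒫 = F`. -/
structure IsSubequation (F : Set (SymMat n)) : Prop where
  nonempty : F.Nonempty
  proper : F ≠ Set.univ
  isClosed : IsClosed F
  convex : Convex ℝ F
  cone : ∀ t : ℝ, 0 ≤ t → ∀ A ∈ F, t • A ∈ F
  positivity : ∀ A ∈ F, ∀ P ∈ Psd n, A + P ∈ F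

/-- The polar cone `F₊ = {B : ⟨A,B⟩ ≥ 0 ∀ A ∈ F}`. -/
def polarCone (F : Set (SymMat n)) : Set (SymMat n) :=
  {B | ∀ A ∈ F, 0 ≤ tinner A B}

/-- The edge `E = F ∩ (−F)`. -/
def edge (F : Set (SymMat n)) : Set (SymMat n) := F ∩ (-F)

/-- Orthogonal complement (as a set) with respect to the trace inner product. -/
def orthSet (E : Set (SymMat n)) : Set (SymMat n) :=
  {B | ∀ A ∈ E, tinner A B = 0}

/-- `P_e = e eᵀ`, orthogonal projection onto the line spanned by `e`, as a symmetric matrix. -/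
def lineProj (e : EuclideanSpace ℝ (Fin n)) : SymMat n :=
  ⟨Matrix.vecMulVec (WithLp.equiv 2 (Fin n → ℝ) e) (WithLp.equiv 2 (Fin n → ℝ) e), by
    refine selfAdjoint.mem_iff.mpr ?_
    ext i j
    simp [Matrix.conjTranspose_apply, Matrix.vecMulVec_apply, mul_comm]⟩

/-- The matrix `P_W` of the orthogonal projection onto a subspace `W ⊆ ℝⁿ`. -/
def projMat (W : Submodule ℝ (EuclideanSpace ℝ (Fin n))) : Matrix (Fin n) (Fin n) ℝ :=
  Matrix.toEuclideanLin.symm ((W.subtypeL.comp (Submodule.orthogonalProjectionOnto W)).toLinearMap)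

/-- `Sym²(W) = {A : A = P_W A P_W}`. -/
def symOn (W : Submodule ℝ (EuclideanSpace ℝ (Fin n))) : Set (SymMat n) :=
  {A | (A : Matrix (Fin n) (Fin n) ℝ) = projMat W * A * projMat W}

/-- The restriction `F_W = {P_W A P_W : A ∈ F}` of `F` to `W` (inside `Sym²(W)`). -/
def restrictTo (F : Set (SymMat n)) (W : Submodule ℝ (EuclideanSpace ℝ (Fin n))) :
    Set (SymMat n) :=
  {B | ∃ A ∈ F, (B : Matrix (Fin n) (Fin n) ℝ) = projMat W * A * projMat W}

/-- `F` is extremely degenerate: the polar cone only involves the variables of some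
proper subspace `W ⊊ ℝⁿ`. -/
def IsExtremelyDegenerate (F : Set (SymMat n)) : Prop :=
  ∃ W : Submodule ℝ (EuclideanSpace ℝ (Fin n)), W ≠ ⊤ ∧ polarCone F ⊆ symOn W

/-- `F` is (dimensionally) complete. -/
def IsComplete (F : Set (SymMat n)) : Prop := ¬ IsExtremelyDegenerate F

/-- The interior of `F` relative to `S`. -/
def relInt (S F : Set (SymMat n)) : Set (SymMat n) :=
  {B | B ∈ S ∧ ∃ U : Set (SymMat n), IsOpen U ∧ B ∈ U ∧ U ∩ S ⊆ F}

/-- The support of `F`: the intersection of all subspaces `W'` with `F₊ ⊆ Sym²(W')`. -/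
def support (F : Set (SymMat n)) : Submodule ℝ (EuclideanSpace ℝ (Fin n)) :=
  sInf {W | polarCone F ⊆ symOn W}

/-- The polar cone of `G` taken within `Sym²(W)`. -/
def polarIn (G : Set (SymMat n)) (W : Submodule ℝ (EuclideanSpace ℝ (Fin n))) :
    Set (SymMat n) :=
  {B | B ∈ symOn W ∧ ∀ A ∈ G, 0 ≤ tinner A B}

end SymMat

namespace SymMat

variable {n : ℕ}

lemma coe_symm (A : SymMat n) : (A : Matrix (Fin n) (Fin n) ℝ)ᵀ = A := by
  have := selfAdjoint.mem_iff.mp A.2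
  rwa [Matrix.star_eq_conjTranspose, Matrix.conjTranspose_eq_transpose_of_trivial] at this

lemma lineProj_coe (e : EuclideanSpace ℝ (Fin n)) :
    (lineProj e : Matrix (Fin n) (Fin n) ℝ) = vecMulVec e.ofLp e.ofLp := rfl

lemma tinner_lineProj (e : EuclideanSpace ℝ (Fin n)) (B : SymMat n) :
    tinner (lineProj e) B = e.ofLp ⬝ᵥ ((B : Matrix (Fin n) (Fin n) ℝ) *ᵥ e.ofLp) := by
  unfold tinner
  rw [lineProj_coe, Matrix.vecMulVec_mul, Matrix.trace_vecMulVec, ← Matrix.mulVec_transpose,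
    coe_symm]

lemma tinner_neg_left (A B : SymMat n) : tinner (-A) B = -tinner A B := by
  simp [tinner]

lemma lineProj_psd (e : EuclideanSpace ℝ (Fin n)) : lineProj e ∈ Psd n := by
  have := Matrix.posSemidef_vecMulVec_self_star e.ofLp
  simpa [Psd, lineProj_coe] using this

lemma IsSubequation.zero_mem {F : Set (SymMat n)} (hF : IsSubequation F) : (0 : SymMat n) ∈ F := by
  obtain ⟨A, hA⟩ := hF.nonempty
  simpa using hF.cone 0 le_rfl A hA

lemma IsSubequation.psd_mem {F : Set (SymMat n)} (hF : IsSubequation F) {A : SymMat n}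
    (hA : A ∈ Psd n) : A ∈ F := by
  simpa using hF.positivity 0 hF.zero_mem A hA

lemma polar_psd {F : Set (SymMat n)} (hF : IsSubequation F) {B : SymMat n}
    (hB : B ∈ polarCone F) : (B : Matrix (Fin n) (Fin n) ℝ).PosSemidef := by
  refine Matrix.PosSemidef.of_dotProduct_mulVec_nonneg ?_ ?_
  · exact selfAdjoint.mem_iff.mp B.2
  · intro x
    have := hB _ (hF.psd_mem (lineProj_psd (WithLp.toLp 2 x)))
    rw [tinner_lineProj] at this
    simpa using this

lemma projMat_mulVec (W : Submodule ℝ (EuclideanSpace ℝ (Fin n))) (x : EuclideanSpace ℝ (Fin n)) :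
    projMat W *ᵥ x.ofLp = ((W.orthogonalProjectionOnto x : W) : EuclideanSpace ℝ (Fin n)).ofLp := by
  have : Matrix.toEuclideanLin (projMat W) x = (W.orthogonalProjectionOnto x : W) := by
    simp [projMat]
  rw [← this]
  rfl

lemma dot_self_of_norm (e : EuclideanSpace ℝ (Fin n)) : e.ofLp ⬝ᵥ e.ofLp = ‖e‖ ^ 2 := by
  rw [EuclideanSpace.real_norm_sq_eq]
  simp [dotProduct, pow_two]

lemma projMat_orth (e : EuclideanSpace ℝ (Fin n)) (he : ‖e‖ = 1) :
    projMat (ℝ ∙ e)ᗮ = 1 - vecMulVec e.ofLp e.ofLp := by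
  apply Matrix.ext_of_mulVec_single
  intro i
  have h := projMat_mulVec (ℝ ∙ e)ᗮ (WithLp.toLp 2 (Pi.single i 1))
  simp only at h
  rw [h, Submodule.coe_orthogonalProjectionOnto_apply, Submodule.starProjection_orthogonal_val,
    Submodule.starProjection_unit_singleton ℝ he, sub_mulVec, vecMulVec_mulVec]
  ext j
  simp [EuclideanSpace.inner_single_right, mul_comm, Matrix.one_apply, Pi.single_apply]

/-- separation -/
lemma mem_of_polar {F : Set (SymMat n)} (hF : IsSubequation F) (X : SymMat n)
    (h : ∀ B ∈ polarCone F, 0 ≤ tinner X B) : X ∈ F := by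
  by_contra hX
  haveI : LocallyConvexSpace ℝ (Matrix (Fin n) (Fin n) ℝ) :=
    inferInstanceAs (LocallyConvexSpace ℝ (Fin n → Fin n → ℝ))
  have hcl : IsClosed (selfAdjoint (Matrix (Fin n) (Fin n) ℝ) : Set (Matrix (Fin n) (Fin n) ℝ)) := by
    have : (selfAdjoint (Matrix (Fin n) (Fin n) ℝ) : Set (Matrix (Fin n) (Fin n) ℝ))
        = {A | star A = A} := by
      ext A; exact selfAdjoint.mem_iff
    rw [this]
    exact isClosed_eq continuous_star continuous_id
  have hclF : IsClosed ((fun A : SymMat n => (A : Matrix (Fin n) (Fin n) ℝ)) '' F) :=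
    hcl.isClosedEmbedding_subtypeVal.isClosedMap _ hF.isClosed
  have hcv : Convex ℝ ((fun A : SymMat n => (A : Matrix (Fin n) (Fin n) ℝ)) '' F) := by
    rintro _ ⟨A, hA, rfl⟩ _ ⟨B, hB, rfl⟩ a b ha hb hab
    exact ⟨a • A + b • B, hF.convex hA hB ha hb hab, by simp⟩
  have hXn : (X : Matrix (Fin n) (Fin n) ℝ) ∉
      ((fun A : SymMat n => (A : Matrix (Fin n) (Fin n) ℝ)) '' F) := by
    rintro ⟨A, hA, hAX⟩
    exact hX (Subtype.ext hAX ▸ hA)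
  obtain ⟨f, u, hfu, hu⟩ := geometric_hahn_banach_point_closed hcv hclF hXn
  have hu0 : u < 0 := by
    simpa using hu _ ⟨0, hF.zero_mem, rfl⟩
  have hpos : ∀ A ∈ F, 0 ≤ f (A : Matrix (Fin n) (Fin n) ℝ) := by
    intro A hA
    by_contra! hneg
    have := hu _ ⟨(u / f A) • A, hF.cone _ (div_nonneg_of_nonpos hu0.le hneg.le) A hA, rfl⟩
    simp only [selfAdjoint.val_smul, map_smul, smul_eq_mul] at this
    rw [div_mul_cancel₀ _ hneg.ne] at this
    exact lt_irrefl _ this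
  let C : Matrix (Fin n) (Fin n) ℝ := Matrix.of fun i j => f (Matrix.single j i 1)
  have hC : ∀ A : Matrix (Fin n) (Fin n) ℝ, f A = (A * C).trace := by
    intro A
    conv_lhs => rw [Matrix.matrix_eq_sum_single A]
    simp only [map_sum, Matrix.trace, Matrix.diag, Matrix.mul_apply, C, Matrix.of_apply]
    refine Finset.sum_congr rfl fun i _ => Finset.sum_congr rfl fun j _ => ?_
    rw [← smul_eq_mul, ← map_smul, Matrix.smul_single, smul_eq_mul, mul_one]
  let B : SymMat n := ⟨(1 / 2 : ℝ) • (C + Cᵀ), by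
    refine selfAdjoint.mem_iff.mpr ?_
    rw [Matrix.star_eq_conjTranspose, Matrix.conjTranspose_eq_transpose_of_trivial]
    simp [add_comm]⟩
  have hB : ∀ A : SymMat n, tinner A B = f (A : Matrix (Fin n) (Fin n) ℝ) := by
    intro A
    have h1 : ((A : Matrix (Fin n) (Fin n) ℝ) * Cᵀ).trace = (A * C).trace := by
      rw [← Matrix.trace_transpose, Matrix.transpose_mul, Matrix.transpose_transpose, coe_symm,
        Matrix.trace_mul_comm]
    rw [hC]
    simp only [tinner, B, Matrix.mul_smul, Matrix.mul_add, Matrix.trace_smul, Matrix.trace_add, h1,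
      smul_eq_mul]
    ring
  have h1 := h B (fun A hA => by rw [hB]; exact hpos A hA)
  rw [hB] at h1
  linarith

lemma exists_unit (W : Submodule ℝ (EuclideanSpace ℝ (Fin n))) (hW : W ≠ ⊤) :
    ∃ e ∈ Wᗮ, ‖e‖ = 1 := by
  have : Wᗮ ≠ ⊥ := fun h => hW (Submodule.orthogonal_eq_bot_iff.mp h)
  obtain ⟨v, hv, hv0⟩ := Submodule.exists_mem_ne_zero_of_ne_bot this
  exact ⟨(‖v‖⁻¹ : ℝ) • v, Submodule.smul_mem _ _ hv, norm_smul_inv_norm hv0⟩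

lemma exists_sub_psd (A : SymMat n) (hA : A ∈ Psd n) (h0 : A ≠ 0) :
    ∃ b : EuclideanSpace ℝ (Fin n), b ≠ 0 ∧ A - lineProj b ∈ Psd n := by
  obtain ⟨M, hM⟩ : ∃ M : Matrix (Fin n) (Fin n) ℝ, (A : Matrix (Fin n) (Fin n) ℝ) = Mᴴ * M := by
    open scoped MatrixOrder in
    exact CStarAlgebra.nonneg_iff_eq_star_mul_self.mp (Matrix.nonneg_iff_posSemidef.mpr hA)
  have : ∃ k, M k ≠ 0 := by
    by_contra! hk
    have : M = 0 := funext hk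
    exact h0 (Subtype.ext (by rw [hM, this]; simp))
  obtain ⟨k, hk⟩ := this
  refine ⟨WithLp.toLp 2 (M k), fun h => hk ?_, ?_⟩
  · simpa using congrArg WithLp.ofLp h
  · have hsum : ((A - lineProj (WithLp.toLp 2 (M k)) : SymMat n) : Matrix (Fin n) (Fin n) ℝ)
        = ∑ l ∈ Finset.univ.erase k, vecMulVec (M l) (star (M l)) := by
      have : (A : Matrix (Fin n) (Fin n) ℝ) = ∑ l, vecMulVec (M l) (star (M l)) := by
        rw [hM]
        ext i j
        simp [Matrix.mul_apply, Matrix.sum_apply, vecMulVec_apply]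
      rw [AddSubgroupClass.coe_sub, this, ← Finset.add_sum_erase _ _ (Finset.mem_univ k),
        lineProj_coe]
      simp
    show Matrix.PosSemidef _
    rw [hsum]
    exact Matrix.posSemidef_sum _ fun l _ => Matrix.posSemidef_vecMulVec_self_star _

end SymMat

open SymMat in
theorem extremely_degenerate_tfae {n : ℕ} (F : Set (SymMat n))
    (hF : IsSubequation F) :
    List.TFAE [
      IsExtremelyDegenerate F,
      edge F ∩ Psd n ≠ {0},
      ∃ e : EuclideanSpace ℝ (Fin n), ‖e‖ = 1 ∧ lineProj e ∈ edge F,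
      ∃ e : EuclideanSpace ℝ (Fin n), ‖e‖ = 1 ∧ -lineProj e ∈ F] := by
  tfae_have 3 → 2 := by
    rintro ⟨e, he, hm⟩ h
    have : lineProj e ∈ ({0} : Set (SymMat n)) := h ▸ ⟨hm, lineProj_psd e⟩
    have h0 : lineProj e = 0 := this
    have h1 : (vecMulVec e.ofLp e.ofLp).trace = 0 := by
      rw [← lineProj_coe, h0]; simp
    rw [Matrix.trace_vecMulVec, dot_self_of_norm, he] at h1
    norm_num at h1
  tfae_have 4 → 3 := by
    rintro ⟨e, he, hm⟩
    exact ⟨e, he, hF.psd_mem (lineProj_psd e), hm⟩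
  tfae_have 2 → 4 := by
    intro h
    have : ∃ A ∈ edge F ∩ Psd n, A ≠ 0 := by
      by_contra! h'
      refine h (Set.Subset.antisymm (fun A hA => h' A hA) ?_)
      rintro _ rfl
      exact ⟨⟨hF.zero_mem, by simpa using hF.zero_mem⟩, by
        show Matrix.PosSemidef _
        exact Matrix.PosSemidef.zero⟩
    obtain ⟨A, ⟨⟨_, hA⟩, hAP⟩, hA0⟩ := this
    obtain ⟨b, hb, hbP⟩ := exists_sub_psd A hAP hA0
    have h1 : -lineProj b ∈ F := by
      have := hF.positivity (-A) hA _ hbP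
      rwa [show -A + (A - lineProj b) = -lineProj b by abel] at this
    refine ⟨(‖b‖⁻¹ : ℝ) • b, norm_smul_inv_norm hb, ?_⟩
    have h2 := hF.cone (‖b‖⁻¹ ^ 2) (by positivity) _ h1
    convert h2 using 1
    apply Subtype.ext
    ext i j
    simp [lineProj_coe, vecMulVec_apply]
    ring
  tfae_have 4 → 1 := by
    rintro ⟨e, he, hm⟩
    refine ⟨(ℝ ∙ e)ᗮ, ?_, ?_⟩
    · intro h
      have h1 : e ∈ (ℝ ∙ e)ᗮ := h ▸ Submodule.mem_top
      have h2 := Submodule.mem_orthogonal_singleton_iff_inner_right.mp h1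
      rw [real_inner_self_eq_norm_sq, he] at h2
      norm_num at h2
    · intro B hB
      have hP := polar_psd hF hB
      have h1 := hB _ hm
      rw [tinner_neg_left, tinner_lineProj] at h1
      have h2 : e.ofLp ⬝ᵥ ((B : Matrix (Fin n) (Fin n) ℝ) *ᵥ e.ofLp) = 0 := by
        have := hP.dotProduct_mulVec_nonneg e.ofLp
        simp only [star_trivial] at this
        linarith
      have h3 : (B : Matrix (Fin n) (Fin n) ℝ) *ᵥ e.ofLp = 0 :=
        (hP.dotProduct_mulVec_zero_iff e.ofLp).mp (by simpa using h2)
      have h4 : e.ofLp ᵥ* (B : Matrix (Fin n) (Fin n) ℝ) = 0 := by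
        rw [← Matrix.mulVec_transpose, coe_symm, h3]
      show (B : Matrix (Fin n) (Fin n) ℝ) = _
      rw [projMat_orth e he, Matrix.sub_mul, Matrix.vecMulVec_mul, h4, Matrix.mul_sub]
      simp [Matrix.mul_vecMulVec, h3]
  tfae_have 1 → 4 := by
    rintro ⟨W, hW, hsub⟩
    obtain ⟨e, heW, he⟩ := exists_unit W hW
    refine ⟨e, he, mem_of_polar hF _ fun B hB => ?_⟩
    have h1 : (B : Matrix (Fin n) (Fin n) ℝ) = projMat W * B * projMat W := hsub hB
    have h2 : projMat W *ᵥ e.ofLp = 0 := by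
      rw [projMat_mulVec, Submodule.orthogonalProjectionOnto_apply_of_mem_orthogonal heW]
      simp
    rw [tinner_neg_left, tinner_lineProj, h1, ← Matrix.mulVec_mulVec, h2]
    simp
  tfae_finish
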